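/- Let g = ⊕_{p∈ℤ} g_p be a pseudo-product graded Lie algebra over ℂ of depth μ with pseudo-product structure (e, f). If g is of irreducible type (i.e., the g_0-modules e and f are irreducible) and μ ≥ 2, then g is finite-dimensional. -/

import Mathlib

open scoped TensorProduct

/-- A ℤ-graded Lie algebra (GLA) structure over `ℂ` on a Lie algebra `L`:
a family of finite-dimensional subspaces forming an internal direct sum and
compatible with the bracket. -/
structure GLA (L : Type) [LieRing L] [LieAlgebra ℂ L] : Type where
  g : ℤ → Submodule ℂ L
  internal : DirectSum.IsInternal g
  bracket_mem : ∀ p q : ℤ, ∀ x ∈ g p, ∀ y ∈ g q, ⁅x, y⁆ ∈ g (p + q)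
  findim : ∀ p : ℤ, FiniteDimensional ℂ (g p)

namespace GLA

variable {L : Type} [LieRing L] [LieAlgebra ℂ L]

/-- A GLA is a fundamental graded Lie algebra (FGLA): it is finite-dimensional,
concentrated in negative degrees, `g₋₁ ≠ 0`, and it is generated by `g₋₁`
(i.e. `g_{p-1} = [g_p, g₋₁]` for all `p < 0`). -/
structure IsFGLA (G : GLA L) : Prop where
  fd : FiniteDimensional ℂ L
  nonneg : ∀ p : ℤ, 0 ≤ p → G.g p = ⊥
  neg_one_ne_bot : G.g (-1) ≠ ⊥
  generated : ∀ p : ℤ, p < 0 →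
    G.g (p - 1) = Submodule.span ℂ {z : L | ∃ x ∈ G.g p, ∃ y ∈ G.g (-1), z = ⁅x, y⁆}

/-- A GLA is of the `μ`-th kind (equivalently, of depth `μ`). -/
def IsOfKind (G : GLA L) (μ : ℕ) : Prop :=
  G.g (-(μ : ℤ)) ≠ ⊥ ∧ ∀ p : ℤ, p < -(μ : ℤ) → G.g p = ⊥

/-- Transitivity of a GLA. -/
def Transitive (G : GLA L) : Prop :=
  ∀ p : ℤ, 0 ≤ p → ∀ x ∈ G.g p,
    (∀ q : ℤ, q < 0 → ∀ y ∈ G.g q, ⁅x, y⁆ = 0) → x = 0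

end GLA

/-- `G` is a free fundamental graded Lie algebra of type `(n, μ)`:
it is an FGLA of the `μ`-th kind with `dim g₋₁ = n`, and every surjective linear map
from `g₋₁` onto the degree `-1` part of an FGLA of the `μ`-th kind extends uniquely
to a graded Lie algebra epimorphism. -/
def IsFreeFGLA {L : Type} [LieRing L] [LieAlgebra ℂ L] (G : GLA L) (n μ : ℕ) : Prop :=
  G.IsFGLA ∧ G.IsOfKind μ ∧ Module.finrank ℂ (G.g (-1)) = n ∧
  ∀ (L' : Type) [LieRing L'] [LieAlgebra ℂ L'] (G' : GLA L'),
    G'.IsFGLA → G'.IsOfKind μ →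
    ∀ φ : (G.g (-1)) →ₗ[ℂ] (G'.g (-1)), Function.Surjective φ →
      ∃! Φ : L →ₗ⁅ℂ⁆ L',
        (∀ p : ℤ, ∀ x ∈ G.g p, Φ x ∈ G'.g p) ∧ Function.Surjective Φ ∧
        ∀ x : G.g (-1), Φ (x : L) = (φ x : L')

/-- A pseudo-product FGLA: an FGLA together with nonzero subspaces `e`, `f` with
`g₋₁ = e ⊕ f` and `[e,e] = [f,f] = 0`. -/
structure IsPPFGLA {L : Type} [LieRing L] [LieAlgebra ℂ L]
    (G : GLA L) (e f : Submodule ℂ L) : Prop where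
  fgla : G.IsFGLA
  e_ne_bot : e ≠ ⊥
  f_ne_bot : f ≠ ⊥
  sup_eq : e ⊔ f = G.g (-1)
  inf_eq : e ⊓ f = ⊥
  lie_ee : ∀ x ∈ e, ∀ y ∈ e, ⁅x, y⁆ = (0 : L)
  lie_ff : ∀ x ∈ f, ∀ y ∈ f, ⁅x, y⁆ = (0 : L)

/-- `(G; e, f)` is a free pseudo-product FGLA of type `(m, n, μ)`. -/
def IsFreePPFGLA {L : Type} [LieRing L] [LieAlgebra ℂ L] (G : GLA L)
    (e f : Submodule ℂ L) (m n μ : ℕ) : Prop :=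
  IsPPFGLA G e f ∧ G.IsOfKind μ ∧
  Module.finrank ℂ e = m ∧ Module.finrank ℂ f = n ∧
  ∀ (L' : Type) [LieRing L'] [LieAlgebra ℂ L'] (G' : GLA L') (e' f' : Submodule ℂ L'),
    IsPPFGLA G' e' f' → G'.IsOfKind μ →
    ∀ φ : (G.g (-1)) →ₗ[ℂ] (G'.g (-1)), Function.Surjective φ →
      (∀ x : L, ∀ hx : x ∈ G.g (-1), x ∈ e → (φ ⟨x, hx⟩ : L') ∈ e') →
      (∀ x : L, ∀ hx : x ∈ G.g (-1), x ∈ f → (φ ⟨x, hx⟩ : L') ∈ f') →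
      ∃! Φ : L →ₗ⁅ℂ⁆ L',
        (∀ p : ℤ, ∀ x ∈ G.g p, Φ x ∈ G'.g p) ∧ Function.Surjective Φ ∧
        ∀ x : G.g (-1), Φ (x : L) = (φ x : L')

/-- `G` (on `LG`, with embedding `ι` of `Lm`) is the prolongation of the FGLA `M`:
`ι` embeds `M` as the negative part of `G`, `G` is transitive, and `G` is maximal among
transitive GLAs with negative part `M`. -/
structure IsProlongation {Lm LG : Type} [LieRing Lm] [LieAlgebra ℂ Lm]
    [LieRing LG] [LieAlgebra ℂ LG] (M : GLA Lm) (G : GLA LG)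
    (ι : Lm →ₗ⁅ℂ⁆ LG) : Prop where
  inj : Function.Injective ι
  graded_neg : ∀ p : ℤ, p < 0 → (M.g p).map ι.toLinearMap = G.g p
  trans : G.Transitive
  max : ∀ (LH : Type) [LieRing LH] [LieAlgebra ℂ LH] (H : GLA LH) (j : Lm →ₗ⁅ℂ⁆ LH),
    Function.Injective j → (∀ p : ℤ, p < 0 → (M.g p).map j.toLinearMap = H.g p) →
    H.Transitive →
    ∃ ψ : LH →ₗ⁅ℂ⁆ LG, Function.Injective ψ ∧
      (∀ p : ℤ, (H.g p).map ψ.toLinearMap ≤ G.g p) ∧ ψ.comp j = ι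

/-- `G` (with embedding `ι`) is the prolongation of the pseudo-product FGLA `(M; e, f)`:
the negative part is `M`, `G` is transitive, the degree-0 part preserves `e` and `f`,
and `G` is maximal among such transitive GLAs. -/
structure IsPPProlongation {Lm LG : Type} [LieRing Lm] [LieAlgebra ℂ Lm]
    [LieRing LG] [LieAlgebra ℂ LG] (M : GLA Lm) (e f : Submodule ℂ Lm) (G : GLA LG)
    (ι : Lm →ₗ⁅ℂ⁆ LG) : Prop where
  inj : Function.Injective ι
  graded_neg : ∀ p : ℤ, p < 0 → (M.g p).map ι.toLinearMap = G.g p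
  trans : G.Transitive
  e_stable : ∀ x ∈ G.g 0, ∀ y ∈ e, ⁅x, ι y⁆ ∈ e.map ι.toLinearMap
  f_stable : ∀ x ∈ G.g 0, ∀ y ∈ f, ⁅x, ι y⁆ ∈ f.map ι.toLinearMap
  max : ∀ (LH : Type) [LieRing LH] [LieAlgebra ℂ LH] (H : GLA LH) (j : Lm →ₗ⁅ℂ⁆ LH),
    Function.Injective j → (∀ p : ℤ, p < 0 → (M.g p).map j.toLinearMap = H.g p) →
    H.Transitive →
    (∀ x ∈ H.g 0, ∀ y ∈ e, ⁅x, j y⁆ ∈ e.map j.toLinearMap) →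
    (∀ x ∈ H.g 0, ∀ y ∈ f, ⁅x, j y⁆ ∈ f.map j.toLinearMap) →
    ∃ ψ : LH →ₗ⁅ℂ⁆ LG, Function.Injective ψ ∧
      (∀ p : ℤ, (H.g p).map ψ.toLinearMap ≤ G.g p) ∧ ψ.comp j = ι

/-- `G` is a finite-dimensional simple graded Lie algebra of type `(A, Pi1)`, where `A`
is the Cartan matrix (with convention `⁅hᵢ, eⱼ⁆ = Aᵢⱼ • eⱼ`) and `Pi1` is the set of
simple roots of degree one: there is a set of Chevalley generators compatible with the
grading, the generators `eᵢ` (resp. `fᵢ`) having degree `1` (resp. `-1`) for `i ∈ Pi1`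
and degree `0` otherwise. -/
def IsSimpleGLAOfType {LG : Type} [LieRing LG] [LieAlgebra ℂ LG] (G : GLA LG)
    {l : ℕ} (A : Matrix (Fin l) (Fin l) ℤ) (Pi1 : Finset (Fin l)) : Prop :=
  FiniteDimensional ℂ LG ∧ LieAlgebra.IsSimple ℂ LG ∧
  ∃ h e f : Fin l → LG,
    LinearIndependent ℂ h ∧ (∀ i, e i ≠ 0) ∧ (∀ i, f i ≠ 0) ∧
    (∀ i j, ⁅h i, h j⁆ = 0) ∧
    (∀ i, ⁅e i, f i⁆ = h i) ∧ (∀ i j, i ≠ j → ⁅e i, f j⁆ = 0) ∧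
    (∀ i j, ⁅h i, e j⁆ = A i j • e j) ∧
    (∀ i j, ⁅h i, f j⁆ = (-(A i j)) • f j) ∧
    LieSubalgebra.lieSpan ℂ LG (Set.range e ∪ Set.range f) = ⊤ ∧
    (∀ i, h i ∈ G.g 0) ∧
    (∀ i, e i ∈ G.g (if i ∈ Pi1 then 1 else 0)) ∧
    (∀ i, f i ∈ G.g (-(if i ∈ Pi1 then 1 else 0)))

/-- The Cartan matrix of type `A_l` (Bourbaki numbering, 0-indexed). -/
def cartanA (l : ℕ) : Matrix (Fin l) (Fin l) ℤ :=
  Matrix.of fun i j =>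
    if i = j then 2
    else if (i : ℕ) + 1 = (j : ℕ) ∨ (j : ℕ) + 1 = (i : ℕ) then -1 else 0

/-- The Cartan matrix of type `B_l` (Bourbaki numbering, 0-indexed; the last simple
root is the short one), with convention `⁅hᵢ, eⱼ⁆ = Aᵢⱼ • eⱼ`, i.e. `Aᵢⱼ = αⱼ(hᵢ)`. -/
def cartanB (l : ℕ) : Matrix (Fin l) (Fin l) ℤ :=
  Matrix.of fun i j =>
    if i = j then 2
    else if (i : ℕ) = l - 1 ∧ (j : ℕ) + 1 = (i : ℕ) then -2
    else if (i : ℕ) + 1 = (j : ℕ) ∨ (j : ℕ) + 1 = (i : ℕ) then -1 else 0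

/-- The Cartan matrix of type `G₂` (Bourbaki numbering, 0-indexed; `α₁` is the short
root), with convention `⁅hᵢ, eⱼ⁆ = Aᵢⱼ • eⱼ`, i.e. `Aᵢⱼ = αⱼ(hᵢ)`. -/
def cartanG2 : Matrix (Fin 2) (Fin 2) ℤ := !![2, -3; -1, 2]

/-- A pseudo-product graded Lie algebra: a transitive GLA whose negative part is an
FGLA equipped with a pseudo-product structure `(e, f)` preserved by `g₀`. -/
structure IsPseudoProductGLA {L : Type} [LieRing L] [LieAlgebra ℂ L]
    (G : GLA L) (e f : Submodule ℂ L) : Prop where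
  trans : G.Transitive
  e_ne_bot : e ≠ ⊥
  f_ne_bot : f ≠ ⊥
  sup_eq : e ⊔ f = G.g (-1)
  inf_eq : e ⊓ f = ⊥
  lie_ee : ∀ x ∈ e, ∀ y ∈ e, ⁅x, y⁆ = (0 : L)
  lie_ff : ∀ x ∈ f, ∀ y ∈ f, ⁅x, y⁆ = (0 : L)
  neg_one_ne_bot : G.g (-1) ≠ ⊥
  generated : ∀ p : ℤ, p < 0 →
    G.g (p - 1) = Submodule.span ℂ {z : L | ∃ x ∈ G.g p, ∃ y ∈ G.g (-1), z = ⁅x, y⁆}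
  depth_bdd : ∃ μ : ℕ, ∀ p : ℤ, p < -(μ : ℤ) → G.g p = ⊥
  e_stable : ∀ x ∈ G.g 0, ∀ y ∈ e, ⁅x, y⁆ ∈ e
  f_stable : ∀ x ∈ G.g 0, ∀ y ∈ f, ⁅x, y⁆ ∈ f

/-- The symmetric square `S²(V)` of a vector space, realized as the subspace of
symmetric tensors in `V ⊗ V`. -/
noncomputable def symSq (V : Type) [AddCommGroup V] [Module ℂ V] : Submodule ℂ (TensorProduct ℂ V V) :=
  LinearMap.eqLocus (TensorProduct.comm ℂ V V).toLinearMap LinearMap.id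

lemma tmul_self_mem_symSq {V : Type} [AddCommGroup V] [Module ℂ V] (x : V) :
    x ⊗ₜ[ℂ] x ∈ symSq V := by
  show (TensorProduct.comm ℂ V V).toLinearMap (x ⊗ₜ[ℂ] x) = LinearMap.id (x ⊗ₜ[ℂ] x)
  simp

namespace GLA

variable {L : Type} [LieRing L] [LieAlgebra ℂ L]

section Periodic

variable (H : ℤ → Submodule ℂ L) (z : L) (s : ℤ)

/-- Sequences `X` with `X k ∈ H k` on which `ad z` acts as the shift by `s`. -/
def shiftSeq : Submodule ℂ (ℤ → L) where
  carrier := {X | (∀ k, X k ∈ H k) ∧ ∀ k, ⁅z, X k⁆ = X (k - s)}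
  add_mem' := fun hX hY => ⟨fun k => add_mem (hX.1 k) (hY.1 k),
    fun k => by simp [hX.2 k, hY.2 k]⟩
  zero_mem' := ⟨fun k => zero_mem _, fun k => by simp⟩
  smul_mem' := fun c X hX => ⟨fun k => (H k).smul_mem c (hX.1 k), fun k => by simp [hX.2 k]⟩

/-- Elements acting on `H` with degree `q` and commuting there with `z`. -/
def shiftActors (q : ℤ) : Submodule ℂ L where
  carrier := {w | ∀ k, ∀ x ∈ H k, ⁅w, x⁆ ∈ H (k + q) ∧ ⁅z, ⁅w, x⁆⁆ = ⁅w, ⁅z, x⁆⁆}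
  add_mem' := fun {a b} ha hb k x hx => by
    refine ⟨?_, ?_⟩
    · rw [add_lie]
      exact add_mem (ha k x hx).1 (hb k x hx).1
    · simp [(ha k x hx).2, (hb k x hx).2]
  zero_mem' := fun k x _ => by simp
  smul_mem' := fun c a ha k x hx => by
    refine ⟨?_, ?_⟩
    · rw [smul_lie]
      exact (H _).smul_mem c (ha k x hx).1
    · simp [(ha k x hx).2]

/-- The action of `shiftActors H z q` on `shiftSeq H z s`. -/
def shiftAction (q : ℤ) : shiftActors H z q →ₗ[ℂ] Module.End ℂ (shiftSeq H z s) where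
  toFun w :=
    { toFun := fun X => ⟨fun k => ⁅(w : L), X.1 (k - q)⁆,
        fun k => by simpa using (w.2 _ _ (X.2.1 (k - q))).1,
        fun k => by
          rw [(w.2 _ _ (X.2.1 (k - q))).2, X.2.2, sub_right_comm]⟩
      map_add' := fun X Y => by ext k; simp
      map_smul' := fun c X => by ext k; simp }
  map_add' := fun a b => by ext X k; simp
  map_smul' := fun c a => by ext X k; simp

variable {H z s}

lemma finiteDimensional_shiftSeq [∀ k, FiniteDimensional ℂ (H k)] (hs : 0 < s) (K : ℤ)
    (hinj : ∀ k, K ≤ k → ∀ x ∈ H k, ⁅z, x⁆ = 0 → x = 0) :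
    FiniteDimensional ℂ (shiftSeq H z s) := by
  let Φ : shiftSeq H z s →ₗ[ℂ] ((k : Finset.Ico K (K + s)) → H k) :=
    { toFun := fun X k => ⟨X.1 k, X.2.1 k⟩
      map_add' := fun X Y => by ext k; simp
      map_smul' := fun c X => by ext k; simp }
  refine FiniteDimensional.of_injective Φ ((injective_iff_map_eq_zero Φ).2 fun X hX => ?_)
  have hwin : ∀ k, K ≤ k → k < K + s → X.1 k = 0 := fun k h1 h2 =>
    congrArg Subtype.val (congrFun hX ⟨k, Finset.mem_Ico.2 ⟨h1, h2⟩⟩)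
  have hup : ∀ n : ℕ, ∀ k, K ≤ k → k < K + s + n → X.1 k = 0 := by
    intro n
    induction n with
    | zero => intro k h1 h2; exact hwin k h1 (by simpa using h2)
    | succ n ih =>
      intro k h1 h2
      by_cases hk : k < K + s
      · exact hwin k h1 hk
      · refine hinj k h1 _ (X.2.1 k) ?_
        rw [X.2.2]
        exact ih _ (by omega) (by push_cast at h2; omega)
  have hdown : ∀ n : ℕ, ∀ k, K - n ≤ k → X.1 k = 0 := by
    intro n
    induction n with
    | zero => intro k h1; exact hup (k - K).toNat k (by simpa using h1) (by push_cast at h1; omega)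
    | succ n ih =>
      intro k h1
      have h2 := X.2.2 (k + s)
      rw [ih (k + s) (by push_cast at h1; omega), add_sub_cancel_right, lie_zero] at h2
      exact h2.symm
  ext k
  exact hdown (K - k).toNat k (by omega)

lemma shiftSeq_eq_bot [∀ k, FiniteDimensional ℂ (H k)] (hs : 0 < s) (K : ℤ)
    (hinj : ∀ k, K ≤ k → ∀ x ∈ H k, ⁅z, x⁆ = 0 → x = 0) {p q : ℤ} (hpq : p + q = -s)
    (hz : z ∈ Submodule.span ℂ
      {w : L | ∃ a ∈ shiftActors H z p, ∃ b ∈ shiftActors H z q, w = ⁅a, b⁆}) :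
    shiftSeq H z s = ⊥ := by
  have := finiteDimensional_shiftSeq hs K hinj
  have key : ∀ w ∈ Submodule.span ℂ
      {w : L | ∃ a ∈ shiftActors H z p, ∃ b ∈ shiftActors H z q, w = ⁅a, b⁆},
      ∃ hw : w ∈ shiftActors H z (-s),
        LinearMap.trace ℂ _ (shiftAction H z s (-s) ⟨w, hw⟩) = 0 := by
    intro w hw
    induction hw using Submodule.span_induction with
    | mem w h =>
      obtain ⟨a, ha, b, hb, rfl⟩ := h
      have hab : ⁅a, b⁆ ∈ shiftActors H z (-s) := by
        intro k x hx
        have hax := ha k x hx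
        have hbx := hb k x hx
        have habx := ha _ _ hbx.1
        have hbax := hb _ _ hax.1
        rw [lie_lie, lie_lie]
        have e1 : k + q + p = k + -s := by omega
        have e2 : k + p + q = k + -s := by omega
        rw [e1] at habx
        rw [e2] at hbax
        refine ⟨sub_mem habx.1 hbax.1, ?_⟩
        rw [lie_sub, habx.2, hbax.2, hbx.2, hax.2]
      refine ⟨hab, ?_⟩
      have : shiftAction H z s (-s) ⟨_, hab⟩ +
          shiftAction H z s q ⟨b, hb⟩ * shiftAction H z s p ⟨a, ha⟩ =
          shiftAction H z s p ⟨a, ha⟩ * shiftAction H z s q ⟨b, hb⟩ := by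
        ext X k
        have e1 : k - p - q = k - -s := by omega
        have e2 : k - q - p = k - -s := by omega
        simp only [shiftAction, LinearMap.coe_mk, AddHom.coe_mk, LinearMap.add_apply,
          Module.End.mul_apply, Submodule.coe_add, Pi.add_apply, e1, e2]
        rw [lie_lie, sub_add_cancel]
      have htr := congrArg (LinearMap.trace ℂ (shiftSeq H z s)) this
      rw [map_add, LinearMap.trace_mul_comm] at htr
      exact add_eq_right.1 htr
    | zero =>
      exact ⟨zero_mem _, by
        rw [show (⟨0, zero_mem _⟩ : shiftActors H z (-s)) = 0 from rfl]; simp⟩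
    | add x y _ _ hx hy =>
      obtain ⟨hx, hx0⟩ := hx
      obtain ⟨hy, hy0⟩ := hy
      refine ⟨add_mem hx hy, ?_⟩
      rw [show (⟨x + y, add_mem hx hy⟩ : shiftActors H z (-s)) = ⟨x, hx⟩ + ⟨y, hy⟩ from rfl,
        map_add, map_add, hx0, hy0, add_zero]
    | smul c x _ hx =>
      obtain ⟨hx, hx0⟩ := hx
      refine ⟨Submodule.smul_mem _ c hx, ?_⟩
      rw [show (⟨c • x, Submodule.smul_mem _ c hx⟩ : shiftActors H z (-s)) = c • ⟨x, hx⟩ from rfl,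
        map_smul, map_smul, hx0, smul_zero]
  obtain ⟨hzs, htr⟩ := key z hz
  have hid : shiftAction H z s (-s) ⟨z, hzs⟩ = 1 := by
    ext X k
    have := X.2.2 (k - -s)
    rw [show k - -s - s = k by omega] at this
    exact this
  rw [hid, LinearMap.trace_one] at htr
  exact Submodule.finrank_eq_zero.1 (by exact_mod_cast htr)

/-- If `ad z` is onto from `H (k + s)` to `H k` along an arithmetic progression, every element
of `H k` extends to a sequence in `shiftSeq H z s`. -/
lemma exists_mem_shiftSeq (hs : 0 < s) (hzH : ∀ k, ∀ x ∈ H k, ⁅z, x⁆ ∈ H (k - s)) (k : ℤ)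
    (hsurj : ∀ n : ℕ, ∀ x ∈ H (k + n * s), ∃ y ∈ H (k + (n + 1 : ℕ) * s), ⁅z, y⁆ = x)
    (x : L) (hx : x ∈ H k) : ∃ X ∈ shiftSeq H z s, X k = x := by
  choose! g hg hgz using hsurj
  let Y : ℕ → L := fun n => Nat.rec x (fun n y => g n y) n
  have hY : ∀ n : ℕ, Y n ∈ H (k + n * s) := by
    intro n
    induction n with
    | zero => simpa [Y] using hx
    | succ n ih => exact hg n _ ih
  let Z : ℕ → L := fun n => Nat.rec x (fun _ y => ⁅z, y⁆) n
  have hZ : ∀ n : ℕ, Z n ∈ H (k - n * s) := by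
    intro n
    induction n with
    | zero => simpa [Z] using hx
    | succ n ih =>
      have := hzH _ _ ih
      rwa [show k - n * s - s = k - (n + 1 : ℕ) * s by push_cast; ring] at this
  let F : ℤ → L := fun n => if 0 ≤ n then Y n.toNat else Z (-n).toNat
  have hF : ∀ n : ℤ, F n ∈ H (k + n * s) := by
    intro n
    by_cases hn : 0 ≤ n
    · have := hY n.toNat
      rw [Int.toNat_of_nonneg hn] at this
      simpa [F, hn] using this
    · have := hZ (-n).toNat
      rw [Int.toNat_of_nonneg (by omega), neg_mul, sub_neg_eq_add] at this
      simpa [F, hn] using this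
  have hFz : ∀ n : ℤ, ⁅z, F n⁆ = F (n - 1) := by
    intro n
    rcases lt_trichotomy n 0 with hn | rfl | hn
    · have h1 : ¬ 0 ≤ n := by omega
      have h2 : ¬ 0 ≤ n - 1 := by omega
      simp only [F, h1, h2, if_false]
      rw [show (-(n - 1)).toNat = (-n).toNat + 1 by omega]
    · simp [F, Y, Z]
    · obtain ⟨m, rfl⟩ : ∃ m : ℕ, n = (m + 1 : ℕ) := ⟨(n - 1).toNat, by omega⟩
      have h1 : (0 : ℤ) ≤ ((m + 1 : ℕ) : ℤ) := by omega
      have h2 : (0 : ℤ) ≤ ((m + 1 : ℕ) : ℤ) - 1 := by omega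
      simp only [F, h1, h2, if_true]
      rw [show (((m + 1 : ℕ) : ℤ) - 1).toNat = m by omega,
        show (((m + 1 : ℕ) : ℤ)).toNat = m + 1 by omega]
      exact hgz m _ (hY m)
  refine ⟨fun j => if s ∣ j - k then F ((j - k) / s) else 0, ⟨fun j => ?_, fun j => ?_⟩, ?_⟩
  · by_cases hj : s ∣ j - k
    · simp only [hj, if_true]
      have := hF ((j - k) / s)
      rwa [Int.ediv_mul_cancel hj, add_sub_cancel] at this
    · simp [hj]
  · have h1 : s ∣ j - s - k ↔ s ∣ j - k := by
      rw [sub_right_comm, dvd_sub_self_right]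
    by_cases hj : s ∣ j - k
    · simp only [h1, hj, if_true]
      rw [hFz, sub_right_comm j s k, Int.sub_ediv_of_dvd _ dvd_rfl, Int.ediv_self hs.ne']
    · simp [h1, hj]
  · simp [F, Y]

lemma eventually_eq_bot [∀ k, FiniteDimensional ℂ (H k)] (hs : 0 < s)
    (hzH : ∀ k, ∀ x ∈ H k, ⁅z, x⁆ ∈ H (k - s)) (K : ℤ)
    (hinj : ∀ k, K ≤ k → ∀ x ∈ H k, ⁅z, x⁆ = 0 → x = 0) {p q : ℤ} (hpq : p + q = -s)
    (hz : z ∈ Submodule.span ℂ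
      {w : L | ∃ a ∈ shiftActors H z p, ∃ b ∈ shiftActors H z q, w = ⁅a, b⁆}) :
    ∃ K', ∀ k, K' ≤ k → H k = ⊥ := by
  have hbot := shiftSeq_eq_bot hs K hinj hpq hz
  let T : ∀ k, H (k + s) →ₗ[ℂ] H k := fun k =>
    { toFun := fun x => ⟨⁅z, (x : L)⁆, by simpa using hzH _ _ x.2⟩
      map_add' := fun x y => by ext; simp
      map_smul' := fun c x => by ext; simp }
  have hT : ∀ k, K ≤ k → Function.Injective (T k) := fun k hk =>
    (injective_iff_map_eq_zero _).2 fun x hx =>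
      Subtype.ext (hinj _ (by omega) _ x.2 (congrArg Subtype.val hx))
  have hanti : ∀ k, K ≤ k → Module.finrank ℂ (H (k + s)) ≤ Module.finrank ℂ (H k) :=
    fun k hk => LinearMap.finrank_le_finrank_of_injective (hT k hk)
  have hsucc : ∀ (k : ℤ) (j : ℕ), k + j * s + s = k + (j + 1 : ℕ) * s := fun k j => by
    push_cast; ring
  have hclass : ∀ k, K ≤ k → ∃ J : ℕ, ∀ j, J ≤ j → H (k + j * s) = ⊥ := by
    intro k hk
    have hge : ∀ j : ℕ, K ≤ k + j * s := fun j => by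
      have : 0 ≤ (j : ℤ) * s := by positivity
      omega
    let d : ℕ → ℕ := fun j => Module.finrank ℂ (H (k + j * s))
    have hd : Antitone d := antitone_nat_of_succ_le fun j => by
      have := hanti _ (hge j)
      rwa [hsucc] at this
    obtain ⟨J, hJ⟩ : ∃ J, ∀ j, d J ≤ d j := ⟨Function.argmin d, fun j => Function.argmin_le d j⟩
    have hJ' : ∀ j, J ≤ j → d J = d j := fun j hj => (hJ j).antisymm (hd hj)
    refine ⟨J, fun j hj => (Submodule.eq_bot_iff _).2 fun x hx => ?_⟩
    have hsurj : ∀ n : ℕ, ∀ y ∈ H (k + j * s + n * s),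
        ∃ w ∈ H (k + j * s + (n + 1 : ℕ) * s), ⁅z, w⁆ = y := by
      intro n y hy
      have e1 : k + j * s + n * s = k + (j + n : ℕ) * s := by push_cast; ring
      have e2 : k + j * s + (n + 1 : ℕ) * s = k + (j + n : ℕ) * s + s := by push_cast; ring
      rw [e1] at hy
      rw [e2]
      have hfin : Module.finrank ℂ (H (k + (j + n : ℕ) * s + s)) =
          Module.finrank ℂ (H (k + (j + n : ℕ) * s)) := by
        rw [hsucc]
        exact (hJ' _ (by omega)).symm.trans (hJ' _ (by omega))
      obtain ⟨w, hw⟩ := (LinearMap.injective_iff_surjective_of_finrank_eq_finrank hfin).1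
        (hT _ (hge _)) ⟨y, hy⟩
      exact ⟨w, w.2, congrArg Subtype.val hw⟩
    obtain ⟨X, hX, hXk⟩ := exists_mem_shiftSeq hs hzH (k + j * s) hsurj x hx
    rw [hbot, Submodule.mem_bot] at hX
    rw [← hXk, hX, Pi.zero_apply]
  choose! J hJ using hclass
  let N := (Finset.Ico K (K + s)).sup J
  refine ⟨K + (N + 1) * s, fun k hk => ?_⟩
  have hmod := Int.emod_nonneg (k - K) hs.ne'
  have hmod' := Int.emod_lt_of_pos (k - K) hs
  have hdiv := Int.emod_add_mul_ediv (k - K) s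
  have hquot : (N : ℤ) ≤ (k - K) / s := by
    rw [Int.le_ediv_iff_mul_le hs]
    nlinarith
  have hk' := hJ (K + (k - K) % s) (by omega) ((k - K) / s).toNat (by
    have : J (K + (k - K) % s) ≤ N := Finset.le_sup (Finset.mem_Ico.2 ⟨by omega, by omega⟩)
    omega)
  rw [Int.toNat_of_nonneg (by omega)] at hk'
  rwa [show K + (k - K) % s + (k - K) / s * s = k by linarith] at hk'

end Periodic

/-- The elements of degree `k` that centralize `S` and everything of degree less than `r`. -/
def centralizerPart (G : GLA L) (r : ℤ) (S : Set L) (k : ℤ) : Submodule ℂ L where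
  carrier := {x | x ∈ G.g k ∧ (∀ y ∈ S, ⁅y, x⁆ = 0) ∧ ∀ p < r, ∀ y ∈ G.g p, ⁅y, x⁆ = 0}
  add_mem' := fun hx hx' => ⟨add_mem hx.1 hx'.1,
    fun y hy => by rw [lie_add, hx.2.1 y hy, hx'.2.1 y hy, add_zero],
    fun p hp y hy => by rw [lie_add, hx.2.2 p hp y hy, hx'.2.2 p hp y hy, add_zero]⟩
  zero_mem' := ⟨zero_mem _, fun y _ => lie_zero y, fun _ _ y _ => lie_zero y⟩
  smul_mem' := fun c x hx => ⟨Submodule.smul_mem _ c hx.1,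
    fun y hy => by rw [lie_smul, hx.2.1 y hy, smul_zero],
    fun p hp y hy => by rw [lie_smul, hx.2.2 p hp y hy, smul_zero]⟩

lemma lie_mem_centralizerPart (G : GLA L) {r q : ℤ} (hq : q < 0) {S : Set L}
    (hS : ∀ y ∈ S, y ∈ G.g r) {a : L} (ha : a ∈ G.g q) {k : ℤ} {x : L}
    (hx : x ∈ G.centralizerPart r S k) : ⁅a, x⁆ ∈ G.centralizerPart r S (k + q) := by
  obtain ⟨hxk, hxS, hxr⟩ := hx
  refine ⟨add_comm q k ▸ G.bracket_mem q k a ha x hxk, fun y hy => ?_, fun p hp y hy => ?_⟩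
  · rw [leibniz_lie, hxS y hy, lie_zero, add_zero]
    exact hxr (r + q) (by omega) _ (G.bracket_mem _ _ _ (hS y hy) _ ha)
  · rw [leibniz_lie, hxr p hp y hy, lie_zero, add_zero]
    exact hxr (p + q) (by omega) _ (G.bracket_mem _ _ _ hy _ ha)

/-- One generator `z` of degree `r ≤ -2` can be dropped from the centralizing set without
losing vanishing in large degrees. -/
lemma centralizerPart_of_insert (G : GLA L)
    (hgen : ∀ p : ℤ, p < 0 →
      G.g (p - 1) = Submodule.span ℂ {z : L | ∃ x ∈ G.g p, ∃ y ∈ G.g (-1), z = ⁅x, y⁆})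
    {r : ℤ} (hr : r ≤ -2) {S : Set L} (hS : ∀ y ∈ S, y ∈ G.g r) {z : L} (hz : z ∈ G.g r)
    (h : ∃ K, ∀ k, K ≤ k → G.centralizerPart r (insert z S) k = ⊥) :
    ∃ K, ∀ k, K ≤ k → G.centralizerPart r S k = ⊥ := by
  obtain ⟨K, hK⟩ := h
  have (k : ℤ) : FiniteDimensional ℂ (G.centralizerPart r S k) := by
    have := G.findim k
    exact Submodule.finiteDimensional_of_le (S₂ := G.g k) fun x hx => hx.1
  have hact : ∀ q : ℤ, q < 0 → G.g q ≤ shiftActors (G.centralizerPart r S) z q := by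
    refine fun q hq a ha k x hx => ⟨G.lie_mem_centralizerPart hq hS ha hx, ?_⟩
    rw [leibniz_lie, hx.2.2 (r + q) (by omega) _ (G.bracket_mem _ _ _ hz _ ha), zero_add]
  refine eventually_eq_bot (s := -r) (z := z) (p := r + 1) (q := -1) (by omega)
    (fun k x hx => ?_) K (fun k hk x hx hzx => ?_) (by omega) ?_
  · rw [sub_neg_eq_add]
    exact G.lie_mem_centralizerPart (by omega) hS hz hx
  · have hmem : x ∈ G.centralizerPart r (insert z S) k :=
      ⟨hx.1, Set.forall_mem_insert.2 ⟨hzx, hx.2.1⟩, hx.2.2⟩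
    rwa [hK k hk, Submodule.mem_bot] at hmem
  · have hspan := hgen (r + 1) (by omega)
    rw [add_sub_cancel_right] at hspan
    rw [hspan] at hz
    refine Submodule.span_mono ?_ hz
    rintro w ⟨a, ha, b, hb, rfl⟩
    exact ⟨a, hact _ (by omega) ha, b, hact _ (by omega) hb, rfl⟩

open scoped Classical in
lemma centralizerPart_empty_of_self (G : GLA L)
    (hgen : ∀ p : ℤ, p < 0 →
      G.g (p - 1) = Submodule.span ℂ {z : L | ∃ x ∈ G.g p, ∃ y ∈ G.g (-1), z = ⁅x, y⁆})
    {r : ℤ} (hr : r ≤ -2)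
    (h : ∃ K, ∀ k, K ≤ k → G.centralizerPart r (G.g r) k = ⊥) :
    ∃ K, ∀ k, K ≤ k → G.centralizerPart r ∅ k = ⊥ := by
  have := G.findim r
  obtain ⟨S, hS⟩ : (G.g r).FG := Module.Finite.iff_fg.1 this
  have hsub : ∀ y ∈ S, y ∈ G.g r := fun y hy => hS ▸ Submodule.subset_span hy
  have hstart : ∃ K, ∀ k, K ≤ k → G.centralizerPart r S k = ⊥ := by
    obtain ⟨K, hK⟩ := h
    refine ⟨K, fun k hk => le_bot_iff.1 (le_trans ?_ (hK k hk).le)⟩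
    refine fun x hx => ⟨hx.1, fun y hy => ?_, hx.2.2⟩
    rw [SetLike.mem_coe, ← hS] at hy
    induction hy using Submodule.span_induction with
    | mem y hy => exact hx.2.1 y hy
    | zero => exact zero_lie x
    | add a b _ _ ha hb => rw [add_lie, ha, hb, add_zero]
    | smul c a _ ha => rw [smul_lie, ha, smul_zero]
  clear hS
  induction S using Finset.induction_on with
  | empty => simpa using hstart
  | insert z S _ ih =>
    refine ih (fun y hy => hsub y (Finset.mem_insert_of_mem hy))
      (G.centralizerPart_of_insert hgen hr
        (fun y hy => hsub y (Finset.mem_insert_of_mem hy)) (hsub z (Finset.mem_insert_self z S)) ?_)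
    simpa using hstart

/-- A GLA of finite depth whose negative part is generated in degree `-1` is finite-dimensional
as soon as only finitely many degrees contain nonzero elements centralizing everything of degree
at most `-2`. -/
theorem finiteDimensional_of_centralizerPart (G : GLA L)
    (hgen : ∀ p : ℤ, p < 0 →
      G.g (p - 1) = Submodule.span ℂ {z : L | ∃ x ∈ G.g p, ∃ y ∈ G.g (-1), z = ⁅x, y⁆})
    (μ : ℕ) (hdepth : ∀ p : ℤ, p < -(μ : ℤ) → G.g p = ⊥)
    (h : ∃ K, ∀ k, K ≤ k → G.centralizerPart (-1) ∅ k = ⊥) : FiniteDimensional ℂ L := by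
  have hall : ∀ n : ℕ, ∃ K, ∀ k, K ≤ k → G.centralizerPart (-1 - n) ∅ k = ⊥ := by
    intro n
    induction n with
    | zero => simpa using h
    | succ n ih =>
      refine G.centralizerPart_empty_of_self hgen (by push_cast; omega) ?_
      obtain ⟨K, hK⟩ := ih
      refine ⟨K, fun k hk => le_bot_iff.1 (le_trans ?_ (hK k hk).le)⟩
      refine fun x hx => ⟨hx.1, fun y hy => hy.elim, fun p hp y hy => ?_⟩
      rcases (show p ≤ -1 - ((n + 1 : ℕ) : ℤ) by push_cast; omega).lt_or_eq with hlt | rfl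
      · exact hx.2.2 p hlt y hy
      · exact hx.2.1 y hy
  obtain ⟨K, hK⟩ := hall μ
  have hbot : ∀ p, p ∉ Finset.Ico (-(μ : ℤ)) K → G.g p = ⊥ := by
    intro p hp
    by_cases hpμ : p < -(μ : ℤ)
    · exact hdepth p hpμ
    · refine le_bot_iff.1 (le_trans ?_
        (hK p (by rw [Finset.mem_Ico] at hp; omega)).le)
      refine fun x hx => ⟨hx, fun y hy => hy.elim, fun q hq y hy => ?_⟩
      rw [hdepth q (by omega), Submodule.mem_bot] at hy
      rw [hy, zero_lie]
  have htop : (⨆ p ∈ Finset.Ico (-(μ : ℤ)) K, G.g p) = ⊤ := by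
    rw [← G.internal.submodule_iSup_eq_top]
    refine le_antisymm (iSup₂_le fun p _ => le_iSup G.g p) (iSup_le fun p => ?_)
    by_cases hp : p ∈ Finset.Ico (-(μ : ℤ)) K
    · exact le_iSup₂ (f := fun p _ => G.g p) p hp
    · simp [hbot p hp]
  have := G.findim
  rw [← Finset.sup_eq_iSup] at htop
  have hfin : FiniteDimensional ℂ ((Finset.Ico (-(μ : ℤ)) K).sup G.g : Submodule ℂ L) :=
    Submodule.finiteDimensional_finset_sup _ _
  rw [htop] at hfin
  exact Module.finite_def.2 (Module.Finite.iff_fg.1 hfin)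

/-- Elements centralizing `g₋₁` centralize the whole negative part. -/
lemma lie_eq_zero_of_lie_neg_one (G : GLA L)
    (hgen : ∀ p : ℤ, p < 0 →
      G.g (p - 1) = Submodule.span ℂ {z : L | ∃ x ∈ G.g p, ∃ y ∈ G.g (-1), z = ⁅x, y⁆})
    {x : L} (hx : ∀ y ∈ G.g (-1), ⁅x, y⁆ = 0) :
    ∀ q : ℤ, q < 0 → ∀ y ∈ G.g q, ⁅x, y⁆ = 0 := by
  have h : ∀ n : ℕ, ∀ y ∈ G.g (-1 - n), ⁅x, y⁆ = 0 := by
    intro n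
    induction n with
    | zero => simpa using hx
    | succ n ih =>
      intro y hy
      rw [show (-1 - ((n + 1 : ℕ) : ℤ)) = (-1 - n) - 1 by push_cast; ring,
        hgen _ (by omega)] at hy
      induction hy using Submodule.span_induction with
      | mem y hy =>
        obtain ⟨a, ha, b, hb, rfl⟩ := hy
        rw [leibniz_lie, ih a ha, hx b hb, zero_lie, lie_zero, add_zero]
      | zero => exact lie_zero x
      | add a b _ _ ha hb => rw [lie_add, ha, hb, add_zero]
      | smul c a _ ha => rw [lie_smul, ha, smul_zero]
  intro q hq y hy
  exact h (-1 - q).toNat y (by rwa [Int.toNat_of_nonneg (by omega), sub_sub_cancel])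

end GLA

namespace IsPseudoProductGLA

variable {L : Type} [LieRing L] [LieAlgebra ℂ L] {G : GLA L} {e f : Submodule ℂ L}

lemma e_le (h : IsPseudoProductGLA G e f) : e ≤ G.g (-1) := h.sup_eq ▸ le_sup_left

lemma f_le (h : IsPseudoProductGLA G e f) : f ≤ G.g (-1) := h.sup_eq ▸ le_sup_right

lemma symm (h : IsPseudoProductGLA G e f) : IsPseudoProductGLA G f e :=
  { h with
    e_ne_bot := h.f_ne_bot
    f_ne_bot := h.e_ne_bot
    sup_eq := sup_comm f e ▸ h.sup_eq
    inf_eq := inf_comm f e ▸ h.inf_eq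
    lie_ee := h.lie_ff
    lie_ff := h.lie_ee
    e_stable := h.f_stable
    f_stable := h.e_stable }

lemma lie_neg_one_eq_zero (h : IsPseudoProductGLA G e f) {x : L} (hxe : ∀ y ∈ e, ⁅x, y⁆ = 0)
    (hxf : ∀ y ∈ f, ⁅x, y⁆ = 0) : ∀ y ∈ G.g (-1), ⁅x, y⁆ = 0 := by
  intro y hy
  rw [← h.sup_eq] at hy
  obtain ⟨a, ha, b, hb, rfl⟩ := Submodule.mem_sup.1 hy
  rw [lie_add, hxe a ha, hxf b hb, add_zero]

lemma exists_lie_ne_zero (h : IsPseudoProductGLA G e f) {μ : ℕ} (hμ : 2 ≤ μ)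
    (hdepth : G.IsOfKind μ) : ∃ u ∈ e, ∃ v ∈ f, ⁅u, v⁆ ≠ 0 := by
  by_contra! hc
  have hab : ∀ x ∈ G.g (-1), ∀ y ∈ G.g (-1), ⁅x, y⁆ = 0 := by
    intro x hx
    rw [← h.sup_eq] at hx
    obtain ⟨a, ha, b, hb, rfl⟩ := Submodule.mem_sup.1 hx
    refine h.lie_neg_one_eq_zero (fun y hy => ?_) fun y hy => ?_
    · rw [add_lie, h.lie_ee a ha y hy, ← lie_skew, hc y hy b hb, neg_zero, add_zero]
    · rw [add_lie, hc a ha y hy, h.lie_ff b hb y hy, add_zero]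
  refine hdepth.1 ?_
  rw [show -(μ : ℤ) = (-(μ : ℤ) + 1) - 1 by ring, h.generated _ (by omega),
    Submodule.span_eq_bot]
  rintro z ⟨x, hx, y, hy, rfl⟩
  rw [← lie_skew, G.lie_eq_zero_of_lie_neg_one h.generated (hab y hy) _ (by omega) x hx, neg_zero]

lemma eq_zero_of_lie_f_eq_zero (h : IsPseudoProductGLA G e f) {μ : ℕ} (hμ : 2 ≤ μ)
    (hdepth : G.IsOfKind μ)
    (he : ∀ W : Submodule ℂ L, W ≤ e →
      (∀ x ∈ G.g 0, ∀ w ∈ W, ⁅x, w⁆ ∈ W) → W = ⊥ ∨ W = e)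
    {u : L} (hu : u ∈ e) (huf : ∀ v ∈ f, ⁅u, v⁆ = 0) : u = 0 := by
  let W : Submodule ℂ L :=
    { carrier := {u | u ∈ e ∧ ∀ v ∈ f, ⁅u, v⁆ = 0}
      add_mem' := fun ha hb => ⟨add_mem ha.1 hb.1, fun v hv => by
        rw [add_lie, ha.2 v hv, hb.2 v hv, add_zero]⟩
      zero_mem' := ⟨zero_mem _, fun v _ => zero_lie v⟩
      smul_mem' := fun c a ha => ⟨e.smul_mem c ha.1, fun v hv => by
        rw [smul_lie, ha.2 v hv, smul_zero]⟩ }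
  have hmem : u ∈ W := ⟨hu, huf⟩
  rcases he W (fun _ hw => hw.1) (fun x hx w hw => ⟨h.e_stable x hx w hw.1, fun v hv => by
    rw [lie_lie, hw.2 v hv, hw.2 _ (h.f_stable x hx v hv), lie_zero, sub_zero]⟩) with hW | hW
  · rwa [hW, Submodule.mem_bot] at hmem
  · obtain ⟨a, ha, b, hb, hab⟩ := h.exists_lie_ne_zero hμ hdepth
    rw [← hW] at ha
    exact absurd (ha.2 b hb) hab

lemma lie_eq_zero_of_degree_one (h : IsPseudoProductGLA G e f) {μ : ℕ} (hμ : 2 ≤ μ)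
    (hdepth : G.IsOfKind μ)
    (he : ∀ W : Submodule ℂ L, W ≤ e →
      (∀ x ∈ G.g 0, ∀ w ∈ W, ⁅x, w⁆ ∈ W) → W = ⊥ ∨ W = e)
    {x : L} (hx : x ∈ G.g 1) (hx2 : ∀ p < -1, ∀ y ∈ G.g p, ⁅x, y⁆ = 0) {u : L} (hu : u ∈ e) :
    ⁅x, u⁆ = 0 := by
  have hxg : ∀ w ∈ G.g (-1), ⁅x, w⁆ ∈ G.g 0 := fun w hw => G.bracket_mem 1 (-1) x hx w hw
  have hsymm : ∀ a ∈ G.g (-1), ∀ b ∈ G.g (-1), ⁅⁅x, a⁆, b⁆ = ⁅⁅x, b⁆, a⁆ := by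
    intro a ha b hb
    have h1 := hx2 _ (by norm_num) _ (G.bracket_mem (-1) (-1) a ha b hb)
    rw [leibniz_lie, ← lie_skew a ⁅x, b⁆, ← sub_eq_add_neg, sub_eq_zero] at h1
    exact h1
  have hmix : ∀ a ∈ e, ∀ b ∈ f, ⁅⁅x, a⁆, b⁆ = 0 := by
    intro a ha b hb
    have h1 : ⁅⁅x, a⁆, b⁆ ∈ e ⊓ f := ⟨by
      rw [hsymm a (h.e_le ha) b (h.f_le hb)]
      exact h.e_stable _ (hxg b (h.f_le hb)) a ha, h.f_stable _ (hxg a (h.e_le ha)) b hb⟩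
    rwa [h.inf_eq, Submodule.mem_bot] at h1
  refine h.trans 0 le_rfl _ (hxg u (h.e_le hu)) (G.lie_eq_zero_of_lie_neg_one h.generated
    (h.lie_neg_one_eq_zero (fun w hw => ?_) (hmix u hu)))
  refine h.eq_zero_of_lie_f_eq_zero hμ hdepth he (h.e_stable _ (hxg u (h.e_le hu)) w hw)
    fun v hv => ?_
  have hzero : ⁅⁅x, u⁆, ⁅w, v⁆⁆ = 0 := by
    have hwv := G.bracket_mem (-1) (-1) w (h.e_le hw) v (h.f_le hv)
    rw [lie_lie, hx2 _ (by norm_num) _ hwv,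
      hx2 _ (by norm_num) _ (G.bracket_mem (-1) _ u (h.e_le hu) _ hwv), lie_zero, sub_zero]
  rw [lie_lie, hzero, hmix u hu v hv, lie_zero, sub_zero]

/-- In positive degrees only zero centralizes everything of degree at most `-2`. -/
lemma centralizerPart_eq_bot (h : IsPseudoProductGLA G e f) {μ : ℕ} (hμ : 2 ≤ μ)
    (hdepth : G.IsOfKind μ)
    (he : ∀ W : Submodule ℂ L, W ≤ e →
      (∀ x ∈ G.g 0, ∀ w ∈ W, ⁅x, w⁆ ∈ W) → W = ⊥ ∨ W = e)
    (hf : ∀ W : Submodule ℂ L, W ≤ f →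
      (∀ x ∈ G.g 0, ∀ w ∈ W, ⁅x, w⁆ ∈ W) → W = ⊥ ∨ W = f) :
    ∀ k : ℤ, 1 ≤ k → G.centralizerPart (-1) ∅ k = ⊥ := by
  intro k hk
  induction k, hk using Int.leInduction with
  | base =>
    refine (Submodule.eq_bot_iff _).2 fun x hx => ?_
    have hx2 : ∀ p < -1, ∀ y ∈ G.g p, ⁅x, y⁆ = 0 := fun p hp y hy => by
      rw [← lie_skew, hx.2.2 p hp y hy, neg_zero]
    exact h.trans 1 zero_le_one x hx.1 (G.lie_eq_zero_of_lie_neg_one h.generated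
      (h.lie_neg_one_eq_zero (fun _ hu => h.lie_eq_zero_of_degree_one hμ hdepth he hx.1 hx2 hu)
        fun _ hu => h.symm.lie_eq_zero_of_degree_one hμ hdepth hf hx.1 hx2 hu))
  | succ k hk ih =>
    refine (Submodule.eq_bot_iff _).2 fun x hx => ?_
    refine h.trans (k + 1) (by omega) x hx.1 (G.lie_eq_zero_of_lie_neg_one h.generated
      fun u hu => ?_)
    have hux := G.lie_mem_centralizerPart (by norm_num) (fun y hy => hy.elim) hu hx
    rw [show k + 1 + -1 = k by omega, ih, Submodule.mem_bot] at hux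
    rw [← lie_skew, hux, neg_zero]

end IsPseudoProductGLA

/-- A pseudo-product GLA of depth `μ ≥ 2` of irreducible type is
finite-dimensional. -/
theorem pp_gla_irreducible_findim {L : Type} [LieRing L] [LieAlgebra ℂ L]
    (G : GLA L) (e f : Submodule ℂ L) (μ : ℕ) (hμ : 2 ≤ μ)
    (hpp : IsPseudoProductGLA G e f) (hdepth : G.IsOfKind μ)
    (he : ∀ W : Submodule ℂ L, W ≤ e →
      (∀ x ∈ G.g 0, ∀ w ∈ W, ⁅x, w⁆ ∈ W) → W = ⊥ ∨ W = e)
    (hf : ∀ W : Submodule ℂ L, W ≤ f →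
      (∀ x ∈ G.g 0, ∀ w ∈ W, ⁅x, w⁆ ∈ W) → W = ⊥ ∨ W = f) :
    FiniteDimensional ℂ L := by
  exact G.finiteDimensional_of_centralizerPart hpp.generated μ hdepth.2
    ⟨1, hpp.centralizerPart_eq_bot hμ hdepth he hf⟩
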